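/- arXiv:2507.04579 — 2 statements merged into one kernel-verified Lean document; each statement's English description precedes it below -/
import Mathlib

section
/- Let s ≥ 3 and n ≥ 30(s+1). If H is an F_5-free 3-graph on n vertices with matching number ν(H) ≤ s and H has exactly s·⌊(n−s)²/4⌋ edges, then H is isomorphic to H_3(n,s), i.e., there is a partition of the vertex set into three parts of sizes s, ⌊(n−s)/2⌋, ⌈(n−s)/2⌉ such that the edges of H are exactly the triples with one vertex in each part. -/
open Finset

/-- `H` is a 3-graph: every edge is a 3-element subset of the vertex set. -/
def IsThreeGraph {n : ℕ} (H : Finset (Finset (Fin n))) : Prop :=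
  ∀ e ∈ H, e.card = 3

/-- `H` is `F₅`-free: there are no five distinct vertices `a b c d e` with
`{a,b,c}, {a,b,d}, {c,d,e} ∈ H`. -/
def F5Free {n : ℕ} (H : Finset (Finset (Fin n))) : Prop :=
  ¬ ∃ a b c d e : Fin n, ({a, b, c, d, e} : Finset (Fin n)).card = 5 ∧
      ({a, b, c} : Finset (Fin n)) ∈ H ∧ ({a, b, d} : Finset (Fin n)) ∈ H ∧
      ({c, d, e} : Finset (Fin n)) ∈ H

/-- The matching number of `H` is at most `s`: every family of pairwise disjoint
edges of `H` has at most `s` members. -/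
def MatchingNumLE {n : ℕ} (H : Finset (Finset (Fin n))) (s : ℕ) : Prop :=
  ∀ M ⊆ H, (∀ e ∈ M, ∀ f ∈ M, e ≠ f → Disjoint e f) → M.card ≤ s

section Relations

variable {V : Type*}

/-- The number of ordered pairs of elements of `W` related by `r`. -/
noncomputable def pairCount (r : V → V → Prop) (W : Finset V) : ℕ :=
  open Classical in ∑ a ∈ W, ∑ b ∈ W, if r a b then 1 else 0

/-- No triangle has two sides in `r` and the third in `q`. -/
def NoMixedTriangle (r q : V → V → Prop) : Prop :=
  ∀ x y z, r x y → r x z → ¬ q y z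

lemma pairCount_le_sq (r : V → V → Prop) (W : Finset V) : pairCount r W ≤ #W ^ 2 := by
  classical
  unfold pairCount
  calc _ ≤ ∑ a ∈ W, ∑ b ∈ W, 1 := by
        gcongr; split_ifs <;> simp
    _ = #W ^ 2 := by simp [sq]

lemma four_mul_sq_div_four (k : ℕ) : 4 * ((k + 2) ^ 2 / 4) = 4 * (k ^ 2 / 4) + 4 * k + 4 := by
  have : (k + 2) ^ 2 = k ^ 2 + (k + 1) * 4 := by ring
  rw [this, Nat.add_mul_div_right _ _ (by norm_num)]
  ring

lemma sq_sub_self_le (k : ℕ) : k ^ 2 ≤ 4 * (k ^ 2 / 4) + 1 := by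
  rcases Nat.even_or_odd' k with ⟨j, rfl | rfl⟩
  · have : (2 * j) ^ 2 = 4 * j ^ 2 := by ring
    omega
  · have : (2 * j + 1) ^ 2 = 4 * (j ^ 2 + j) + 1 := by ring
    omega

open Classical in
lemma two_step_weight_le {r q : V → V → Prop} (hrs : ∀ a b, r a b → r b a)
    (hqs : ∀ a b, q a b → q b a) (hrq : NoMixedTriangle r q) (hqr : NoMixedTriangle q r)
    {x y : V} (hr : r x y) (hq : q x y) (z : V) :
    ((if r x z then 1 else 0) + if r y z then 1 else 0) +
      ((if q x z then 1 else 0) + if q y z then 1 else 0) ≤ 2 := by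
  have h1 : r x z → ¬ q y z := hrq x y z hr
  have h2 : q x z → ¬ r y z := hqr x y z hq
  have h3 : r x z → ¬ r y z := fun a b => hrq z x y (hrs _ _ a) (hrs _ _ b) hq
  have h4 : q x z → ¬ q y z := fun a b => hqr z x y (hqs _ _ a) (hqs _ _ b) hr
  split_ifs <;> first | omega | (exfalso; grind only)

lemma pairCount_add_le_of_disjoint {r q : V → V → Prop} (hri : ∀ a, ¬ r a a)
    (hqi : ∀ a, ¬ q a a) {W : Finset V} (h : ∀ x ∈ W, ∀ y ∈ W, r x y → ¬ q x y) :
    pairCount r W + pairCount q W + #W ≤ #W ^ 2 := by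
  classical
  unfold pairCount
  have : ∑ a ∈ W, ∑ b ∈ W, (if a = b then 1 else 0) = #W := by simp
  calc _ = ∑ a ∈ W, ∑ b ∈ W, ((if r a b then 1 else 0) + (if q a b then 1 else 0) +
          if a = b then 1 else 0) := by simp only [sum_add_distrib, this]
    _ ≤ ∑ a ∈ W, ∑ b ∈ W, 1 := by
        refine sum_le_sum fun a ha => sum_le_sum fun b hb => ?_
        have := h a ha b hb
        by_cases hab : a = b
        · subst hab; simp [hri, hqi]
        · simp only [hab, if_false]
          split_ifs <;> first | omega | tauto
    _ = #W ^ 2 := by simp [sq]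

lemma pairCount_mul_le {r q : V → V → Prop} (hrs : ∀ a b, r a b → r b a)
    (hqs : ∀ a b, q a b → q b a)
    (hrq : NoMixedTriangle r q) (hqr : NoMixedTriangle q r) {W : Finset V}
    (hdis : ∀ x ∈ W, ∀ y ∈ W, r x y → ¬ q x y) :
    pairCount r W * pairCount q W + 2 * #W ^ 2 * (pairCount r W + pairCount q W) ≤
      2 * #W ^ 4 := by
  classical
  let i : V → V → ℤ := fun a b => if r a b then 1 else 0
  let j : V → V → ℤ := fun a b => if q a b then 1 else 0
  let m : V → V → ℤ := fun a b => 1 - i a b - j a b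
  have hA : (pairCount r W : ℤ) = ∑ a ∈ W, ∑ b ∈ W, i a b := by simp [pairCount, i]
  have hB : (pairCount q W : ℤ) = ∑ a ∈ W, ∑ b ∈ W, j a b := by simp [pairCount, j]
  have hM : ∑ a ∈ W, ∑ b ∈ W, m a b = (#W : ℤ) ^ 2 - pairCount r W - pairCount q W := by
    rw [hA, hB]; simp [m, sum_sub_distrib, sq]
  have hm : ∀ a ∈ W, ∀ b ∈ W, (r a b ∧ m a b = 0) ∨ (q a b ∧ m a b = 0) ∨ m a b = 1 := by
    intro a ha b hb
    have := hdis a ha b hb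
    by_cases h1 : r a b <;> by_cases h2 : q a b <;> simp_all [m, i, j]
  have hm0 : ∀ a ∈ W, ∀ b ∈ W, 0 ≤ m a b := by
    intro a ha b hb
    rcases hm a ha b hb with h | h | h <;> omega
  have hside : ∀ x ∈ W, ∀ z ∈ W, ∀ w ∈ W, q z w → (q x z ∧ q x w) ∨ 1 ≤ m x z + m x w := by
    intro x hx z hz w hw h
    rcases hm x hx z hz with ⟨h1, h1'⟩ | ⟨h1, h1'⟩ | h1 <;>
      rcases hm x hx w hw with ⟨h2, h2'⟩ | ⟨h2, h2'⟩ | h2 <;> try omega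
    · exact (hrq x z w h1 h2 h).elim
    · exact (hqr w z x (hqs _ _ h) (hqs _ _ h2) (hrs _ _ h1)).elim
    · exact (hqr z w x h (hqs _ _ h1) (hrs _ _ h2)).elim
    · exact Or.inl ⟨h1, h2⟩
  have hopp : ∀ x ∈ W, ∀ y ∈ W, ∀ z ∈ W, r x y → q x z → m y z = 1 := by
    intro x hx y hy z hz h h'
    rcases hm y hy z hz with ⟨h1, -⟩ | ⟨h1, -⟩ | h1
    · exact (hrq y x z (hrs _ _ h) h1 h').elim
    · exact (hqr z x y (hqs _ _ h') (hqs _ _ h1) h).elim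
    · exact h1
  have hpt : ∀ x ∈ W, ∀ y ∈ W, ∀ z ∈ W, ∀ w ∈ W,
      2 * (i x y * j z w) ≤ m x z + m x w + m y z + m y w := by
    intro x hx y hy z hz w hw
    have e1 := hm0 x hx z hz
    have e2 := hm0 x hx w hw
    have e3 := hm0 y hy z hz
    have e4 := hm0 y hy w hw
    by_cases h1 : r x y
    · by_cases h2 : q z w
      · have hij : i x y * j z w = 1 := by simp [i, j, h1, h2]
        rw [hij]
        rcases hside x hx z hz w hw h2 with ⟨h3, h4⟩ | h3
        · have := hopp x hx y hy z hz h1 h3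
          have := hopp x hx y hy w hw h1 h4
          omega
        · rcases hside y hy z hz w hw h2 with ⟨h5, h6⟩ | h5
          · have := hopp y hy x hx z hz (hrs _ _ h1) h5
            have := hopp y hy x hx w hw (hrs _ _ h1) h6
            omega
          · omega
      · have hij : i x y * j z w = 0 := by simp [j, h2]
        omega
    · have hij : i x y * j z w = 0 := by simp [i, h1]
      omega
  have hsum : ∑ x ∈ W, ∑ y ∈ W, ∑ z ∈ W, ∑ w ∈ W, 2 * (i x y * j z w) ≤
      ∑ x ∈ W, ∑ y ∈ W, ∑ z ∈ W, ∑ w ∈ W, (m x z + m x w + m y z + m y w) :=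
    sum_le_sum fun x hx => sum_le_sum fun y hy => sum_le_sum fun z hz => sum_le_sum fun w hw =>
      hpt x hx y hy z hz w hw
  have hL : ∑ x ∈ W, ∑ y ∈ W, ∑ z ∈ W, ∑ w ∈ W, 2 * (i x y * j z w) =
      2 * (pairCount r W * pairCount q W : ℤ) := by
    rw [hA, hB]
    simp only [← mul_sum, ← sum_mul]
  have hR : ∑ x ∈ W, ∑ y ∈ W, ∑ z ∈ W, ∑ w ∈ W, (m x z + m x w + m y z + m y w) =
      4 * ((#W : ℤ) ^ 2 * ∑ a ∈ W, ∑ b ∈ W, m a b) := by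
    simp only [sum_add_distrib, sum_const, nsmul_eq_mul, ← mul_sum]
    ring
  rw [hL, hR, hM] at hsum
  zify
  nlinarith [hsum]

variable [DecidableEq V]

open Classical in
lemma pairCount_insert (r : V → V → Prop) (hs : ∀ a b, r a b → r b a) (hi : ∀ a, ¬ r a a)
    {W : Finset V} {x : V} (hx : x ∉ W) :
    pairCount r (insert x W) = pairCount r W + 2 * ∑ z ∈ W, if r x z then 1 else 0 := by
  unfold pairCount
  rw [sum_insert hx, sum_insert hx]
  simp only [hi, if_false, sum_insert hx, sum_add_distrib]
  have : ∀ z, (if r z x then (1 : ℕ) else 0) = if r x z then 1 else 0 := fun z => by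
    simp only [show r z x ↔ r x z from ⟨hs _ _, hs _ _⟩]
  simp only [this]
  ring

open Classical in
lemma pairCount_insert_two (r : V → V → Prop) (hs : ∀ a b, r a b → r b a) (hi : ∀ a, ¬ r a a)
    {W : Finset V} {x y : V} (hx : x ∉ W) (hy : y ∉ W) (hxy : r x y) :
    pairCount r (insert x (insert y W)) = pairCount r W + 2 +
      2 * ∑ z ∈ W, ((if r x z then 1 else 0) + if r y z then 1 else 0) := by
  have hne : x ≠ y := by rintro rfl; exact hi _ hxy
  rw [pairCount_insert r hs hi (by simp [hne, hx]), pairCount_insert r hs hi hy, sum_insert hy,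
    if_pos hxy, sum_add_distrib]
  ring

lemma exists_insert_two {W : Finset V} {x y : V} (hx : x ∈ W) (hy : y ∈ W) (hne : x ≠ y) :
    ∃ W' : Finset V, x ∉ W' ∧ y ∉ W' ∧ insert x (insert y W') = W ∧ #W = #W' + 2 := by
  refine ⟨(W.erase x).erase y, by simp, by simp, ?_, ?_⟩
  · rw [insert_erase (by simp [hne.symm, hy]), insert_erase hx]
  · have h1 := card_erase_add_one hx
    have h2 := card_erase_add_one (show y ∈ W.erase x by simp [hne.symm, hy])
    omega

lemma pairCount_add_le {r q : V → V → Prop} (hrs : ∀ a b, r a b → r b a)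
    (hqs : ∀ a b, q a b → q b a) (hri : ∀ a, ¬ r a a) (hqi : ∀ a, ¬ q a a)
    (hrq : NoMixedTriangle r q) (hqr : NoMixedTriangle q r) (W : Finset V) :
    pairCount r W + pairCount q W ≤ 4 * (#W ^ 2 / 4) := by
  classical
  induction h : #W using Nat.strong_induction_on generalizing W with
  | _ k ih =>
  by_cases hex : ∃ x ∈ W, ∃ y ∈ W, r x y ∧ q x y
  · obtain ⟨x, hx, y, hy, hr, hq⟩ := hex
    have hne : x ≠ y := by rintro rfl; exact hri _ hr
    obtain ⟨W', hx', hy', rfl, hcard⟩ := exists_insert_two hx hy hne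
    have hW' := ih #W' (by omega) W' rfl
    rw [pairCount_insert_two r hrs hri hx' hy' hr, pairCount_insert_two q hqs hqi hx' hy' hq]
    have hsum := sum_le_card_nsmul W' _ 2
      (fun z _ => two_step_weight_le hrs hqs hrq hqr hr hq z)
    rw [sum_add_distrib, smul_eq_mul] at hsum
    have := four_mul_sq_div_four #W'
    rw [← h, hcard]
    omega
  · push Not at hex
    have h1 := pairCount_add_le_of_disjoint hri hqi hex
    have h2 := sq_sub_self_le k
    rw [h] at h1
    rcases Nat.eq_zero_or_pos k with rfl | hk
    · omega
    · omega

lemma pairCount_le_of_bipartite {r : V → V → Prop} {W X Y : Finset V}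
    (h : ∀ a ∈ W, ∀ b ∈ W, r a b → (a ∈ X ∧ b ∈ Y) ∨ (a ∈ Y ∧ b ∈ X)) :
    pairCount r W ≤ 2 * (#X * #Y) ∧
      (2 * (#X * #Y) ≤ pairCount r W → ∀ a ∈ X, ∀ b ∈ Y, r a b) := by
  classical
  have hcount : pairCount r W = #{p ∈ W ×ˢ W | r p.1 p.2} := by
    rw [card_filter, sum_product]; rfl
  have hsub : {p ∈ W ×ˢ W | r p.1 p.2} ⊆ X ×ˢ Y ∪ Y ×ˢ X := by
    intro p hp
    simp only [mem_filter, mem_product, mem_union] at hp ⊢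
    exact h _ hp.1.1 _ hp.1.2 hp.2
  have hle : #(X ×ˢ Y ∪ Y ×ˢ X) ≤ 2 * (#X * #Y) := by
    refine (card_union_le _ _).trans ?_
    rw [card_product, card_product]
    linarith [mul_comm #X #Y]
  refine ⟨hcount ▸ (card_le_card hsub).trans hle, fun hc a ha b hb => ?_⟩
  have heq := eq_of_subset_of_card_le hsub (by omega)
  have : (a, b) ∈ X ×ˢ Y ∪ Y ×ˢ X := by simp [ha, hb]
  rw [← heq] at this
  exact (mem_filter.1 this).2

lemma exists_bipartition_of_pairCount_eq {r q : V → V → Prop} (hrs : ∀ a b, r a b → r b a)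
    (hqs : ∀ a b, q a b → q b a) (hri : ∀ a, ¬ r a a) (hqi : ∀ a, ¬ q a a)
    (hrq : NoMixedTriangle r q) (hqr : NoMixedTriangle q r) {W : Finset V} (hW : 2 ≤ #W)
    (hr : pairCount r W = 2 * (#W ^ 2 / 4)) (hq : pairCount q W = 2 * (#W ^ 2 / 4)) :
    ∃ X Y : Finset V, Disjoint X Y ∧ X ∪ Y = W ∧ #X * #Y = #W ^ 2 / 4 ∧
      ∀ a ∈ W, ∀ b ∈ W, (r a b ↔ (a ∈ X ∧ b ∈ Y) ∨ (a ∈ Y ∧ b ∈ X)) ∧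
        (q a b ↔ (a ∈ X ∧ b ∈ Y) ∨ (a ∈ Y ∧ b ∈ X)) := by
  classical
  have hex : ∃ x ∈ W, ∃ y ∈ W, r x y ∧ q x y := by
    by_contra! hcon
    have h1 := pairCount_add_le_of_disjoint hri hqi hcon
    have h2 := sq_sub_self_le #W
    omega
  obtain ⟨x, hx, y, hy, hrxy, hqxy⟩ := hex
  have hne : x ≠ y := by rintro rfl; exact hri _ hrxy
  have hsplit : ∀ z ∈ W, z ≠ x → z ≠ y →
      (r x z ∧ q x z ∧ ¬ r y z ∧ ¬ q y z) ∨ (r y z ∧ q y z ∧ ¬ r x z ∧ ¬ q x z) := by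
    obtain ⟨W', hx', hy', rfl, hcard⟩ := exists_insert_two hx hy hne
    have hW' := pairCount_add_le hrs hqs hri hqi hrq hqr W'
    rw [hcard] at hr hq
    rw [pairCount_insert_two r hrs hri hx' hy' hrxy] at hr
    rw [pairCount_insert_two q hqs hqi hx' hy' hqxy] at hq
    have hpt := fun z => two_step_weight_le hrs hqs hrq hqr hrxy hqxy z
    have hfour := four_mul_sq_div_four #W'
    have hsum : ∑ z ∈ W', (((if r x z then 1 else 0) + if r y z then 1 else 0) +
      ((if q x z then 1 else 0) + if q y z then 1 else 0)) = ∑ z ∈ W', 2 := by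
      apply le_antisymm (sum_le_sum fun z _ => hpt z)
      rw [sum_add_distrib, sum_const, smul_eq_mul]
      omega
    have hall := (sum_eq_sum_iff_of_le (fun z _ => hpt z)).1 hsum
    intro z hz hzx hzy
    have hz' := hall z (by simpa [hzx, hzy] using hz)
    have h1 : r x z → ¬ q y z := hrq x y z hrxy
    have h2 : q x z → ¬ r y z := hqr x y z hqxy
    have h3 : r x z → ¬ r y z := fun a b => hrq z x y (hrs _ _ a) (hrs _ _ b) hqxy
    have h4 : q x z → ¬ q y z := fun a b => hqr z x y (hqs _ _ a) (hqs _ _ b) hrxy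
    split_ifs at hz' <;> first | omega | grind only
  have hX : ∀ z ∈ W, (r y z ↔ q y z) := by
    intro z hz
    by_cases h1 : z = x
    · subst h1; exact ⟨fun _ => hqs _ _ hqxy, fun _ => hrs _ _ hrxy⟩
    by_cases h2 : z = y
    · subst h2; simp [hri, hqi]
    have := hsplit z hz h1 h2; tauto
  have hY : ∀ z ∈ W, (r y z ↔ ¬ r x z) ∧ (r x z ↔ q x z) := by
    intro z hz
    by_cases h1 : z = x
    · subst h1; simp [hri, hqi, hrs _ _ hrxy]
    by_cases h2 : z = y
    · subst h2; simp [hri, hrxy, hqxy]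
    have := hsplit z hz h1 h2; tauto
  let X := {z ∈ W | r y z}
  let Y := {z ∈ W | ¬ r y z}
  have hXY : Disjoint X Y := disjoint_filter_filter_not _ _ _
  have hun : X ∪ Y = W := filter_union_filter_not_eq _ _
  have hrsub : ∀ a ∈ W, ∀ b ∈ W, r a b → (a ∈ X ∧ b ∈ Y) ∨ (a ∈ Y ∧ b ∈ X) := by
    intro a ha b hb hab
    simp only [X, Y, mem_filter, ha, hb, true_and]
    have := hqr y a b
    have := hqr x a b
    have := hX a ha; have := hX b hb; have := hY a ha; have := hY b hb
    grind only
  have hqsub : ∀ a ∈ W, ∀ b ∈ W, q a b → (a ∈ X ∧ b ∈ Y) ∨ (a ∈ Y ∧ b ∈ X) := by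
    intro a ha b hb hab
    simp only [X, Y, mem_filter, ha, hb, true_and]
    have := hrq y a b
    have := hrq x a b
    have := hX a ha; have := hX b hb; have := hY a ha; have := hY b hb
    grind only
  have hcard : #X + #Y = #W := by rw [← hun, card_union_of_disjoint hXY]
  have hle : #X * #Y ≤ #W ^ 2 / 4 := by
    rw [Nat.le_div_iff_mul_le (by norm_num), ← hcard]
    zify; nlinarith [sq_nonneg ((#X : ℤ) - #Y)]
  have hr1 := (pairCount_le_of_bipartite hrsub).2 (by omega)
  have hq1 := (pairCount_le_of_bipartite hqsub).2 (by omega)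
  refine ⟨X, Y, hXY, hun, ?_, fun a ha b hb => ⟨⟨hrsub a ha b hb, ?_⟩, ⟨hqsub a ha b hb, ?_⟩⟩⟩
  · apply le_antisymm hle
    have := (pairCount_le_of_bipartite hrsub).1
    omega
  · rintro (⟨h1, h2⟩ | ⟨h1, h2⟩)
    · exact hr1 _ h1 _ h2
    · exact hrs _ _ (hr1 _ h2 _ h1)
  · rintro (⟨h1, h2⟩ | ⟨h1, h2⟩)
    · exact hq1 _ h1 _ h2
    · exact hqs _ _ (hq1 _ h2 _ h1)

end Relations

section Links

variable {n : ℕ} {H : Finset (Finset (Fin n))}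

lemma IsThreeGraph.ne_of_mem (h3 : IsThreeGraph H) {a b c : Fin n}
    (h : ({a, b, c} : Finset (Fin n)) ∈ H) : a ≠ b ∧ a ≠ c ∧ b ≠ c := by
  have hc := h3 _ h
  refine ⟨?_, ?_, ?_⟩ <;> rintro rfl
  · have := card_le_two (a := a) (b := c)
    simp at hc; omega
  · have := card_le_two (a := a) (b := b)
    rw [pair_comm b a] at hc
    simp at hc; omega
  · have := card_le_two (a := a) (b := b)
    simp at hc; omega

lemma F5Free.elim (hF5 : F5Free H) (h3 : IsThreeGraph H) {a b c d e : Fin n}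
    (h1 : ({a, b, c} : Finset (Fin n)) ∈ H) (h2 : ({a, b, d} : Finset (Fin n)) ∈ H)
    (h : ({c, d, e} : Finset (Fin n)) ∈ H) (hea : e ≠ a) (heb : e ≠ b) : False := by
  obtain ⟨n1, n2, n3⟩ := h3.ne_of_mem h1
  obtain ⟨-, n4, n5⟩ := h3.ne_of_mem h2
  obtain ⟨n6, n7, n8⟩ := h3.ne_of_mem h
  refine hF5 ⟨a, b, c, d, e, ?_, h1, h2, h⟩
  rw [card_insert_of_notMem, card_insert_of_notMem, card_insert_of_notMem, card_pair n8] <;>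
    simp [*, hea.symm, heb.symm]

lemma triple_swap (a b c : Fin n) : ({a, b, c} : Finset (Fin n)) = {a, c, b} := by
  rw [pair_comm]

lemma triple_rotate (a b c : Fin n) : ({a, b, c} : Finset (Fin n)) = {b, c, a} := by
  ext; simp; tauto

/-- The link graph of `u` in `H`, restricted to the complement of `S`. -/
def link (H : Finset (Finset (Fin n))) (S : Finset (Fin n)) (u a b : Fin n) : Prop :=
  a ∉ S ∧ b ∉ S ∧ ({u, a, b} : Finset (Fin n)) ∈ H

/-- The number of edges of `H` containing both `u` and `v`. -/
def codegree (H : Finset (Finset (Fin n))) (u v : Fin n) : ℕ :=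
  #{x | ({u, v, x} : Finset (Fin n)) ∈ H}

lemma link_symm (S : Finset (Fin n)) (u a b : Fin n) (h : link H S u a b) :
    link H S u b a :=
  ⟨h.2.1, h.1, triple_swap u a b ▸ h.2.2⟩

lemma link_irrefl (h3 : IsThreeGraph H) (S : Finset (Fin n)) (u a : Fin n) :
    ¬ link H S u a a :=
  fun h => (h3.ne_of_mem h.2.2).2.2 rfl

lemma noMixedTriangle_link (h3 : IsThreeGraph H) (hF5 : F5Free H) {S : Finset (Fin n)}
    {u v : Fin n} (hv : v ∈ S) (huv : u ≠ v) :
    NoMixedTriangle (link H S u) (link H S v) := by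
  rintro x y z ⟨hx, -, h1⟩ ⟨-, -, h2⟩ ⟨-, -, h⟩
  rw [triple_rotate] at h
  exact hF5.elim h3 h1 h2 h huv.symm (fun e => hx (e ▸ hv))

lemma codegree_self (h3 : IsThreeGraph H) (u : Fin n) : codegree H u u = 0 := by
  rw [codegree, card_eq_zero, filter_eq_empty_iff]
  exact fun x _ h => (h3.ne_of_mem h).1 rfl

lemma codegree_le (u v : Fin n) : codegree H u v ≤ n :=
  (card_filter_le (univ : Finset (Fin n)) _).trans (card_fin n).le

lemma card_compl_add_card_fin (S : Finset (Fin n)) : #Sᶜ + #S = n := by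
  have := card_le_univ S
  rw [card_compl]
  rw [Fintype.card_fin] at *
  omega

lemma two_mul_card_touching_le (h3 : IsThreeGraph H) (S : Finset (Fin n)) :
    2 * #{e ∈ H | ¬ Disjoint e S} ≤
      ∑ u ∈ S, (pairCount (link H S u) Sᶜ + ∑ v ∈ S, codegree H u v) := by
  classical
  let Q : Fin n → Finset (Fin n × Fin n) := fun u =>
    {p | ({u, p.1, p.2} : Finset (Fin n)) ∈ H ∧ (p.1 ∈ S ∨ p.1 ∉ S ∧ p.2 ∉ S)}
  let f : (Σ _ : Fin n, Fin n × Fin n) → Finset (Fin n) := fun p => {p.1, p.2.1, p.2.2}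
  have hQ : ∀ u, #(Q u) ≤ pairCount (link H S u) Sᶜ + ∑ v ∈ S, codegree H u v := by
    intro u
    have hsub : Q u ⊆ {p ∈ Sᶜ ×ˢ Sᶜ | link H S u p.1 p.2} ∪
        {p ∈ S ×ˢ (univ : Finset (Fin n)) | ({u, p.1, p.2} : Finset (Fin n)) ∈ H} := by
      intro p hp
      simp only [Q, mem_filter, mem_univ, true_and] at hp
      simp only [mem_filter, mem_univ, mem_union, mem_product, mem_compl, and_true]
      unfold link
      tauto
    refine (card_le_card hsub).trans ((card_union_le _ _).trans (le_of_eq ?_))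
    congr 1
    · rw [card_filter, sum_product]; rfl
    · rw [card_filter, sum_product]
      exact sum_congr rfl fun v _ => (card_filter _ _).symm
  have hmaps : ∀ p ∈ S.sigma Q, f p ∈ ({e ∈ H | ¬ Disjoint e S} : Finset (Finset (Fin n))) := by
    rintro ⟨u, a, b⟩ hp
    simp only [Q, mem_sigma, mem_filter, mem_univ, true_and] at hp
    refine mem_filter.2 ⟨hp.2.1, fun h => disjoint_left.1 h (mem_insert_self u _) hp.1⟩
  have hfib : ∀ e ∈ ({e ∈ H | ¬ Disjoint e S} : Finset (Finset (Fin n))),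
      2 ≤ #{p ∈ S.sigma Q | f p = e} := by
    intro e he
    obtain ⟨heH, hd⟩ := mem_filter.1 he
    obtain ⟨u, hue, huS⟩ := not_disjoint_iff.1 hd
    have hc : #(e.erase u) = 2 := by rw [card_erase_of_mem hue, h3 e heH]
    obtain ⟨a, b, hab, heab⟩ := card_eq_two.1 hc
    have hee : e = {u, a, b} := by rw [← heab, insert_erase hue]
    subst hee
    have hne := h3.ne_of_mem heH
    apply one_lt_card.2
    by_cases ha : a ∈ S
    · refine ⟨⟨u, a, b⟩, ?_, ⟨a, u, b⟩, ?_, ?_⟩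
      · simp [Q, f, huS, ha, heH]
      · have : ({a, u, b} : Finset (Fin n)) = {u, a, b} := by rw [insert_comm]
        simp [Q, f, huS, ha, heH, this]
      · simp [hne.1]
    by_cases hb : b ∈ S
    · have e1 : ({u, b, a} : Finset (Fin n)) = {u, a, b} := triple_swap _ _ _
      have e2 : ({b, u, a} : Finset (Fin n)) = {u, a, b} := triple_rotate _ _ _
      refine ⟨⟨u, b, a⟩, ?_, ⟨b, u, a⟩, ?_, ?_⟩
      · simp [Q, f, huS, hb, heH, e1]
      · simp [Q, f, huS, hb, heH, e2]
      · simp [hne.2.1]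
    · have e1 : ({u, b, a} : Finset (Fin n)) = {u, a, b} := triple_swap _ _ _
      refine ⟨⟨u, a, b⟩, ?_, ⟨u, b, a⟩, ?_, ?_⟩
      · simp [Q, f, huS, ha, hb, heH]
      · simp [Q, f, huS, ha, hb, heH, e1]
      · simp [hab]
  calc 2 * #{e ∈ H | ¬ Disjoint e S} ≤ #(S.sigma Q) := by
        rw [card_eq_sum_card_fiberwise hmaps, mul_comm, ← smul_eq_mul]
        exact card_nsmul_le_sum _ _ _ hfib
    _ ≤ _ := by
        rw [card_sigma]
        exact sum_le_sum fun u _ => hQ u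

lemma pairCount_le_erase (h3 : IsThreeGraph H) (S W : Finset (Fin n)) (u x : Fin n) :
    pairCount (link H S u) (W.erase x) ≤ pairCount (link H S u) W ∧
    pairCount (link H S u) W ≤ pairCount (link H S u) (W.erase x) + 2 * #W := by
  classical
  by_cases hx : x ∈ W
  · have h := pairCount_insert (link H S u) (link_symm S u) (link_irrefl h3 S u)
      (notMem_erase x W)
    rw [insert_erase hx] at h
    have h2 : ∑ z ∈ W.erase x, (if link H S u x z then 1 else 0) ≤ #W := by
      refine le_trans ?_ (card_le_card (erase_subset x W))
      rw [card_eq_sum_ones]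
      gcongr; split_ifs <;> simp
    omega
  · rw [erase_eq_of_notMem hx]; omega

lemma sum_sq_bound_contradiction {A B C p q : ℤ} (hA : 0 ≤ A) (hB : 0 ≤ B) (hq : 0 ≤ q)
    (hqp : q ≤ p) (hAB : A + B ≤ q ^ 2) (hmul : A * B + 2 * q ^ 2 * (A + B) ≤ 2 * q ^ 4)
    (hAp : 5 * A ≤ 3 * p ^ 2) (hBp : 5 * B ≤ 3 * p ^ 2) (hC : p ^ 2 ≤ A + B + C)
    (hCD : 25 * C ≤ 2 * p ^ 2) (hp : 0 < p) : False := by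
  have h1 : q ^ 2 ≤ p ^ 2 := by nlinarith
  have h2 : A * B ≤ 2 * (q ^ 2 * (q ^ 2 - (A + B))) := by nlinarith
  have h3 : q ^ 2 * (q ^ 2 - (A + B)) ≤ p ^ 2 * C :=
    mul_le_mul h1 (by linarith) (by linarith) (by positivity)
  have hP : 0 < p ^ 2 := by positivity
  generalize p ^ 2 = P at *
  have hA' : 8 * P ≤ 25 * A := by linarith
  have hB' : 8 * P ≤ 25 * B := by linarith
  have h4 : 0 ≤ (25 * A - 8 * P) * (25 * B - 8 * P) :=
    mul_nonneg (by linarith) (by linarith)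
  nlinarith

lemma pairCount_add_lt_of_codegree_pos (h3 : IsThreeGraph H) (hF5 : F5Free H)
    {S : Finset (Fin n)} (hS : 3 ≤ #S) (hn : 30 * (#S + 1) ≤ n) {u v : Fin n} (hu : u ∈ S)
    (hv : v ∈ S) (huv : codegree H u v ≠ 0)
    (hcu : 5 * pairCount (link H S u) Sᶜ ≤ 3 * #Sᶜ ^ 2)
    (hcv : 5 * pairCount (link H S v) Sᶜ ≤ 3 * #Sᶜ ^ 2) :
    pairCount (link H S u) Sᶜ + pairCount (link H S v) Sᶜ + 2 * (#S - 1) * n <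
      4 * (#Sᶜ ^ 2 / 4) := by
  obtain ⟨x, hx⟩ := card_pos.1 (Nat.pos_of_ne_zero huv)
  simp only [mem_filter, mem_univ, true_and] at hx
  have hne := (h3.ne_of_mem hx).1
  set W := Sᶜ
  have hdis : ∀ a ∈ W.erase x, ∀ b ∈ W.erase x, link H S u a b → ¬ link H S v a b := by
    rintro a ha b hb ⟨-, -, h1⟩ ⟨-, -, h2⟩
    rw [triple_rotate] at h1 h2
    exact hF5.elim h3 h1 h2 hx (ne_of_mem_erase ha).symm (ne_of_mem_erase hb).symm
  have hmul := pairCount_mul_le (link_symm S u) (link_symm S v)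
    (noMixedTriangle_link h3 hF5 hv hne) (noMixedTriangle_link h3 hF5 hu hne.symm) hdis
  have hadd := pairCount_add_le_of_disjoint (link_irrefl h3 S u) (link_irrefl h3 S v) hdis
  obtain ⟨hu1, hu2⟩ := pairCount_le_erase h3 S W u x
  obtain ⟨hv1, hv2⟩ := pairCount_le_erase h3 S W v x
  have hq : #(W.erase x) ≤ #W := card_le_card (erase_subset x W)
  have hW : #W + #S = n := card_compl_add_card_fin S
  have hfl := sq_sub_self_le #W
  generalize pairCount (link H S u) (W.erase x) = A at *
  generalize pairCount (link H S v) (W.erase x) = B at *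
  generalize pairCount (link H S u) W = A' at *
  generalize pairCount (link H S v) W = B' at *
  generalize #(W.erase x) = q at *
  generalize #W = p at *
  generalize #S = s at *
  obtain ⟨t, rfl⟩ : ∃ t, s = t + 1 := ⟨s - 1, by omega⟩
  by_contra! hcon
  rw [Nat.add_sub_cancel] at hcon
  have hC : p ^ 2 ≤ A + B + (2 * t * n + 4 * p + 1) := by omega
  zify at *
  refine sum_sq_bound_contradiction (A := A) (B := B) (p := p) (q := q)
    (C := 2 * t * n + 4 * p + 1) (by positivity) (by positivity) (by positivity) hq
    (by linarith) hmul (by linarith) (by linarith) hC ?_ (by linarith)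
  have hn' : (n : ℤ) = p + (t + 1) := by linarith
  rw [hn'] at hn ⊢
  have ht0 : (0 : ℤ) ≤ t := by positivity
  nlinarith

lemma card_mul_sum_le {V : Type*} [DecidableEq V] {S : Finset V} (hS : 2 ≤ #S) {c : V → ℕ}
    {N : V → V → ℕ} {K : ℕ} (hN : ∀ u ∈ S, N u u = 0)
    (h : ∀ u ∈ S, ∀ v ∈ S, u ≠ v → c u + c v + 2 * (#S - 1) * N u v ≤ 2 * K) :
    ∑ u ∈ S, (c u + ∑ v ∈ S, N u v) ≤ #S * K ∧
      (∑ u ∈ S, (c u + ∑ v ∈ S, N u v) = #S * K →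
        ∀ u ∈ S, ∀ v ∈ S, u ≠ v → c u + c v + 2 * (#S - 1) * N u v = 2 * K) := by
  obtain ⟨t, ht⟩ : ∃ t, #S = t + 1 := ⟨#S - 1, by omega⟩
  have ht' : #S - 1 = t := by omega
  rw [ht'] at h ⊢
  have hL : ∑ u ∈ S, ∑ v ∈ S.erase u, (c u + c v + 2 * t * N u v) =
      2 * t * ∑ u ∈ S, (c u + ∑ v ∈ S, N u v) := by
    have hin : ∀ u ∈ S, ∑ v ∈ S.erase u, (c u + c v + 2 * t * N u v) + c u =
        t * c u + ∑ v ∈ S, c v + 2 * t * ∑ v ∈ S, N u v := by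
      intro u hu
      have h1 := add_sum_erase S c hu
      have h2 := add_sum_erase S (N u) hu
      rw [hN u hu, zero_add] at h2
      rw [sum_add_distrib, sum_add_distrib, sum_const, card_erase_of_mem hu, ht', ← mul_sum, h2,
        ← h1, smul_eq_mul]
      ring
    have := sum_congr rfl hin
    simp only [sum_add_distrib, sum_const, ← mul_sum, smul_eq_mul, ht] at this ⊢
    linarith
  have hR : ∑ u ∈ S, ∑ v ∈ S.erase u, 2 * K = 2 * t * (#S * K) := by
    rw [sum_congr rfl (fun u hu => by
      rw [sum_const, card_erase_of_mem hu, ht', smul_eq_mul]), sum_const, smul_eq_mul]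
    ring
  have hle : ∀ u ∈ S, ∑ v ∈ S.erase u, (c u + c v + 2 * t * N u v) ≤ ∑ v ∈ S.erase u, 2 * K :=
    fun u hu => sum_le_sum fun v hv =>
      h u hu v (mem_of_mem_erase hv) (ne_of_mem_erase hv).symm
  have hpos : 0 < 2 * t := by omega
  refine ⟨Nat.le_of_mul_le_mul_left (hL ▸ hR ▸ sum_le_sum hle) hpos, fun heq u hu v hv huv => ?_⟩
  rw [← heq, ← hL] at hR
  have h1 := (sum_eq_sum_iff_of_le hle).1 hR.symm u hu
  exact (sum_eq_sum_iff_of_le fun v hv =>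
      h u hu v (mem_of_mem_erase hv) (ne_of_mem_erase hv).symm).1 h1 v
    (mem_erase.2 ⟨huv.symm, hv⟩)

lemma pairCount_link_add_le (h3 : IsThreeGraph H) (hF5 : F5Free H) {S : Finset (Fin n)}
    {u v : Fin n} (hu : u ∈ S) (hv : v ∈ S) (huv : u ≠ v) :
    pairCount (link H S u) Sᶜ + pairCount (link H S v) Sᶜ ≤ 4 * (#Sᶜ ^ 2 / 4) :=
  pairCount_add_le (link_symm S u) (link_symm S v) (link_irrefl h3 S u) (link_irrefl h3 S v)
    (noMixedTriangle_link h3 hF5 hv huv) (noMixedTriangle_link h3 hF5 hu huv.symm) _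

lemma large_link_arith {C K X Y p r : ℤ} (hr : 0 ≤ r) (hp : 29 * r + 117 ≤ p)
    (hC : 3 * p ^ 2 < 5 * C) (hX : X + (r + 2) * C ≤ (r + 2) * p ^ 2)
    (hY : Y ≤ (r + 2 + 1) * ((r + 2) * (p + (r + 3)))) (hK : p ^ 2 ≤ 4 * K + 1) :
    X + C + Y < (r + 3) * (2 * K) := by
  obtain ⟨k, hk⟩ : ∃ k : ℤ, p = 29 * r + 117 + k := ⟨p - (29 * r + 117), by ring⟩
  have hk0 : 0 ≤ k := by linarith
  have e1 : 3 * ((r + 1) * p ^ 2) ≤ 5 * ((r + 1) * C) := by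
    nlinarith [mul_le_mul_of_nonneg_left hC.le (by linarith : 0 ≤ r + 1)]
  have e2 := mul_le_mul_of_nonneg_left hK (by linarith : 0 ≤ r + 3)
  have e3 : 0 < (r + 1) * p ^ 2 - 10 * (r + 3) * (r + 2) * (p + (r + 3)) - 5 * (r + 3) := by
    rw [hk]; ring_nf; positivity
  linarith

lemma sum_touching_lt_of_large_link (h3 : IsThreeGraph H) (hF5 : F5Free H) {S : Finset (Fin n)}
    (hS : 3 ≤ #S) (hn : 30 * (#S + 1) ≤ n) {u : Fin n} (hu : u ∈ S)
    (hlarge : 3 * #Sᶜ ^ 2 < 5 * pairCount (link H S u) Sᶜ) :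
    ∑ u ∈ S, (pairCount (link H S u) Sᶜ + ∑ v ∈ S, codegree H u v) <
      #S * (2 * (#Sᶜ ^ 2 / 4)) := by
  obtain ⟨c, hc⟩ : ∃ c : Fin n → ℕ, ∀ v, pairCount (link H S v) Sᶜ = c v := ⟨_, fun _ => rfl⟩
  have hpair := fun v (hv : v ∈ S) (h : u ≠ v) => pairCount_link_add_le h3 hF5 hu hv h
  simp only [hc] at hpair hlarge ⊢
  have hW : #Sᶜ + #S = n := card_compl_add_card_fin S
  have hfl := sq_sub_self_le #Sᶜ
  have hdiv := Nat.mul_div_le (#Sᶜ ^ 2) 4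
  generalize #Sᶜ = p at *
  obtain ⟨t, ht⟩ : ∃ t, #S = t + 1 := ⟨#S - 1, by omega⟩
  have h1 : ∑ v ∈ S.erase u, (c v + c u) ≤ t * p ^ 2 := by
    refine (sum_le_card_nsmul _ _ (p ^ 2) fun v hv => ?_).trans (le_of_eq ?_)
    · have := hpair v (mem_of_mem_erase hv) (ne_of_mem_erase hv).symm
      omega
    · rw [card_erase_of_mem hu, ht]; rfl
  rw [sum_add_distrib, sum_const, card_erase_of_mem hu, ht, smul_eq_mul,
    Nat.add_sub_cancel] at h1
  have h2 := sum_erase_add S c hu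
  have h4 : ∑ u ∈ S, ∑ v ∈ S, codegree H u v ≤ (t + 1) * (t * n) := by
    rw [← ht, ← smul_eq_mul]
    refine sum_le_card_nsmul _ _ _ fun u hu => ?_
    rw [← sum_erase S (codegree_self h3 u)]
    refine (sum_le_card_nsmul _ _ n fun v _ => codegree_le u v).trans (le_of_eq ?_)
    rw [card_erase_of_mem hu, ht]; rfl
  rw [sum_add_distrib, ← h2, ht]
  rw [ht] at hn hW
  obtain ⟨r, rfl⟩ : ∃ r, t = r + 2 := ⟨t - 2, by omega⟩
  generalize ∑ v ∈ S.erase u, c v = X at *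
  generalize ∑ u ∈ S, ∑ v ∈ S, codegree H u v = Y at *
  generalize p ^ 2 / 4 = K at *
  generalize c u = C at *
  have hr : (0 : ℤ) ≤ r := by positivity
  have hn' : (n : ℤ) = p + (r + 3) := by omega
  zify at h1 h4 hfl hlarge ⊢
  have := large_link_arith (p := p) hr (by omega) hlarge h1 (hn' ▸ h4) hfl
  linarith

lemma sum_touching_le (h3 : IsThreeGraph H) (hF5 : F5Free H) {S : Finset (Fin n)}
    (hS : 3 ≤ #S) (hn : 30 * (#S + 1) ≤ n) :
    ∑ u ∈ S, (pairCount (link H S u) Sᶜ + ∑ v ∈ S, codegree H u v) ≤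
        #S * (2 * (#Sᶜ ^ 2 / 4)) ∧
      (∑ u ∈ S, (pairCount (link H S u) Sᶜ + ∑ v ∈ S, codegree H u v) =
        #S * (2 * (#Sᶜ ^ 2 / 4)) →
        (∀ u ∈ S, ∀ v ∈ S, codegree H u v = 0) ∧
        ∀ u ∈ S, pairCount (link H S u) Sᶜ = 2 * (#Sᶜ ^ 2 / 4)) := by
  by_cases hlarge : ∃ u ∈ S, 3 * #Sᶜ ^ 2 < 5 * pairCount (link H S u) Sᶜ
  · obtain ⟨u, hu, hlarge⟩ := hlarge
    have := sum_touching_lt_of_large_link h3 hF5 hS hn hu hlarge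
    exact ⟨this.le, fun h => absurd h this.ne⟩
  push Not at hlarge
  have hlt : ∀ u ∈ S, ∀ v ∈ S, codegree H u v ≠ 0 →
      pairCount (link H S u) Sᶜ + pairCount (link H S v) Sᶜ +
        2 * (#S - 1) * codegree H u v < 4 * (#Sᶜ ^ 2 / 4) := fun u hu v hv h =>
    (Nat.add_le_add_left (Nat.mul_le_mul_left _ (codegree_le u v)) _).trans_lt
      (pairCount_add_lt_of_codegree_pos h3 hF5 hS hn hu hv h (hlarge u hu) (hlarge v hv))
  have hmain := card_mul_sum_le (c := fun u => pairCount (link H S u) Sᶜ)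
    (N := codegree H) (K := 2 * (#Sᶜ ^ 2 / 4)) (S := S) (by omega)
    (fun u _ => codegree_self h3 u) (by
      intro u hu v hv huv
      by_cases h : codegree H u v = 0
      · have := pairCount_link_add_le h3 hF5 hu hv huv
        rw [h]; omega
      · have := hlt u hu v hv h
        omega)
  refine ⟨hmain.1, fun heq => ?_⟩
  have htight := hmain.2 heq
  have hzero : ∀ u ∈ S, ∀ v ∈ S, codegree H u v = 0 := by
    intro u hu v hv
    by_contra h
    have h1 := hlt u hu v hv h
    have h2 := htight u hu v hv (by rintro rfl; exact h (codegree_self h3 u))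
    omega
  refine ⟨hzero, fun u hu => ?_⟩
  obtain ⟨v, hv, hvu⟩ := exists_mem_ne (by omega : 1 < #S) u
  obtain ⟨w, hw, hwne⟩ : ∃ w ∈ S, w ∉ ({u, v} : Finset (Fin n)) :=
    exists_mem_notMem_of_card_lt_card (by have := card_le_two (a := u) (b := v); omega)
  simp only [mem_insert, mem_singleton, not_or] at hwne
  have h1 := htight u hu v hv hvu.symm
  have h2 := htight u hu w hw (Ne.symm hwne.1)
  have h3 := htight v hv w hw (Ne.symm hwne.2)
  simp only [hzero u hu v hv, hzero u hu w hw, hzero v hv w hw] at h1 h2 h3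
  omega

end Links

section Peeling

variable {n : ℕ} {H : Finset (Finset (Fin n))}

lemma card_meeting_through_le (h3 : IsThreeGraph H) (hF5 : F5Free H) {e : Finset (Fin n)}
    (he : e ∈ H) {v : Fin n} (hv : v ∉ e) :
    #{f ∈ H | v ∈ f ∧ ¬ Disjoint f e} ≤ n + 6 := by
  have hsub : ({f ∈ H | v ∈ f ∧ ¬ Disjoint f e} : Finset (Finset (Fin n))) ⊆
      univ.biUnion fun x : Fin n =>
        ({y ∈ e | ({v, x, y} : Finset (Fin n)) ∈ H} : Finset (Fin n)).image
          fun y => ({v, x, y} : Finset (Fin n)) := by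
    intro f hf
    obtain ⟨hfH, hvf, hd⟩ := mem_filter.1 hf
    obtain ⟨y, hyf, hye⟩ := not_disjoint_iff.1 hd
    have hyv : y ≠ v := fun h => hv (h ▸ hye)
    have hc : #((f.erase v).erase y) = 1 := by
      rw [card_erase_of_mem (mem_erase.2 ⟨hyv, hyf⟩), card_erase_of_mem hvf, h3 f hfH]
    obtain ⟨x, hx⟩ := card_eq_one.1 hc
    have hf' : ({v, x, y} : Finset (Fin n)) = f := by
      rw [triple_swap, ← hx, insert_erase (mem_erase.2 ⟨hyv, hyf⟩), insert_erase hvf]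
    simp only [mem_biUnion, mem_univ, true_and, mem_image, mem_filter]
    exact ⟨x, y, ⟨hye, hf' ▸ hfH⟩, hf'⟩
  have hone : ∀ x, #({y ∈ e | ({v, x, y} : Finset (Fin n)) ∈ H} : Finset (Fin n)) ≤
      1 + if x ∈ e then 2 else 0 := by
    intro x
    split_ifs with hxe
    · exact (card_filter_le _ _).trans (h3 e he).le
    · refine card_le_one.2 fun a ha b hb => ?_
      by_contra hab
      obtain ⟨hae, h1⟩ := mem_filter.1 ha
      obtain ⟨hbe, h2⟩ := mem_filter.1 hb
      have hc : #((e.erase a).erase b) = 1 := by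
        rw [card_erase_of_mem (mem_erase.2 ⟨Ne.symm hab, hbe⟩), card_erase_of_mem hae, h3 e he]
      obtain ⟨c, hc⟩ := card_eq_one.1 hc
      have hce : ({a, b, c} : Finset (Fin n)) = e := by
        rw [← hc, insert_erase (mem_erase.2 ⟨Ne.symm hab, hbe⟩), insert_erase hae]
      have hcm : c ∈ e := by rw [← hce]; simp
      exact hF5.elim h3 h1 h2 (hce ▸ he) (fun h => hv (h ▸ hcm)) (fun h => hxe (h ▸ hcm))
  calc _ ≤ ∑ x : Fin n, (1 + if x ∈ e then 2 else 0) :=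
        (card_le_card hsub).trans (card_biUnion_le.trans
          (sum_le_sum fun x _ => card_image_le.trans (hone x)))
    _ = n + 6 := by
        rw [sum_add_distrib, sum_ite_mem, univ_inter, sum_const, sum_const, h3 e he]
        simp

lemma card_through_le_of_maximal_matching (h3 : IsThreeGraph H) (hF5 : F5Free H)
    {K M : Finset (Finset (Fin n))} (hKH : K ⊆ H) (hMK : M ⊆ K) {v : Fin n}
    (hvM : ∀ e ∈ M, v ∉ e) (hmeet : ∀ f ∈ K, ∃ e ∈ M, ¬ Disjoint f e) :
    #{f ∈ K | v ∈ f} ≤ #M * (n + 6) := by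
  have hsub : ({f ∈ K | v ∈ f} : Finset (Finset (Fin n))) ⊆
      M.biUnion fun e => {f ∈ H | v ∈ f ∧ ¬ Disjoint f e} := by
    intro f hf
    obtain ⟨hfK, hvf⟩ := mem_filter.1 hf
    obtain ⟨e, he, hd⟩ := hmeet f hfK
    exact mem_biUnion.2 ⟨e, he, mem_filter.2 ⟨hKH hfK, hvf, hd⟩⟩
  refine (card_le_card hsub).trans (card_biUnion_le.trans ?_)
  exact sum_le_card_nsmul _ _ _ fun e he =>
    card_meeting_through_le h3 hF5 (hKH (hMK he)) (hvM e he)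

lemma exists_not_disjoint_of_matchingNumLE {K M : Finset (Finset (Fin n))} {m : ℕ}
    (h3 : IsThreeGraph K)
    (hK : MatchingNumLE K m) (hMK : M ⊆ K) (hM : ∀ e ∈ M, ∀ f ∈ M, e ≠ f → Disjoint e f)
    (hm : m ≤ #M) {f : Finset (Fin n)} (hf : f ∈ K) : ∃ e ∈ M, ¬ Disjoint f e := by
  by_contra! hcon
  have hfM : f ∉ M := by
    intro h
    have := hcon f h
    rw [disjoint_self_iff_empty] at this
    have h3f := h3 f hf
    rw [this] at h3f
    simp at h3f
  have := hK (insert f M) (insert_subset hf hMK) (by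
    intro e he e' he' hne
    rcases mem_insert.1 he with rfl | heM <;> rcases mem_insert.1 he' with rfl | heM'
    · exact absurd rfl hne
    · exact hcon _ heM'
    · exact (hcon _ heM).symm
    · exact hM _ heM _ heM' hne)
  rw [card_insert_of_notMem hfM] at this
  omega

/-- Some set `S` of at most `s` vertices meets all but `O((s - #S)² n)` edges. -/
lemma exists_removal (h3 : IsThreeGraph H) (hF5 : F5Free H) {s : ℕ} (hsn : s < n)
    (hν : MatchingNumLE H s) :
    ∃ S : Finset (Fin n), #S ≤ s ∧
      #{e ∈ H | Disjoint e S} ≤ 3 * (s - #S) * ((s - #S) * (n + 6)) := by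
  classical
  let P : Finset (Finset (Fin n)) :=
    {S | #S ≤ s ∧ MatchingNumLE {e ∈ H | Disjoint e S} (s - #S)}
  have hP : P.Nonempty := ⟨∅, by simpa [P] using hν⟩
  obtain ⟨S, hS, hmax⟩ := exists_max_image P card hP
  simp only [P, mem_filter, mem_univ, true_and] at hS hmax
  obtain ⟨hSs, hSν⟩ := hS
  refine ⟨S, hSs, ?_⟩
  set K : Finset (Finset (Fin n)) := {e ∈ H | Disjoint e S} with hKdef
  have hKH : K ⊆ H := filter_subset _ _
  have h3K : IsThreeGraph K := fun e he => h3 e (hKH he)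
  rcases Nat.eq_zero_or_pos (s - #S) with h0 | hpos
  · rw [h0] at hSν ⊢
    have hKe : K = ∅ := by
      rw [eq_empty_iff_forall_notMem]
      intro f hf
      obtain ⟨e, he, -⟩ := exists_not_disjoint_of_matchingNumLE h3K hSν (empty_subset K)
        (by simp) (by simp) hf
      simp at he
    simp [hKe]
  have hexM : ∀ v, v ∉ S → ∃ M ⊆ K, (∀ e ∈ M, v ∉ e) ∧ s - #S = #M ∧
      ∀ f ∈ K, ∃ e ∈ M, ¬ Disjoint f e := by
    intro v hv
    by_contra! hcon
    have hc := card_insert_of_notMem hv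
    have := hmax (insert v S) ⟨by omega, fun M hM hMd => ?_⟩
    · omega
    · have hMK : M ⊆ K := fun e he => by
        have := mem_filter.1 (hM he)
        exact mem_filter.2 ⟨this.1, (disjoint_insert_right.1 this.2).2⟩
      have hvM : ∀ e ∈ M, v ∉ e := fun e he =>
        (disjoint_insert_right.1 (mem_filter.1 (hM he)).2).1
      by_contra hlt
      have hle := hSν M hMK hMd
      obtain ⟨f, hf, hfM⟩ := hcon M hMK hvM (by omega)
      obtain ⟨e, he, hd⟩ := exists_not_disjoint_of_matchingNumLE h3K hSν hMK hMd (by omega) hf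
      exact hd (hfM e he)
  have hdeg : ∀ v, v ∉ S → #{f ∈ K | v ∈ f} ≤ (s - #S) * (n + 6) := by
    intro v hv
    obtain ⟨M, hMK, hvM, hcard, hmeet⟩ := hexM v hv
    exact hcard ▸ card_through_le_of_maximal_matching h3 hF5 hKH hMK hvM hmeet
  obtain ⟨v, -, hv⟩ : ∃ v ∈ (univ : Finset (Fin n)), v ∉ S :=
    exists_mem_notMem_of_card_lt_card (by rw [card_univ, Fintype.card_fin]; omega)
  obtain ⟨M, hMK, -, hcard, hmeet⟩ := hexM v hv
  have hsub : K ⊆ (M.biUnion id).biUnion fun v => {f ∈ K | v ∈ f} := by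
    intro f hf
    obtain ⟨e, he, hd⟩ := hmeet f hf
    obtain ⟨x, hxf, hxe⟩ := not_disjoint_iff.1 hd
    exact mem_biUnion.2 ⟨x, mem_biUnion.2 ⟨e, he, hxe⟩, mem_filter.2 ⟨hf, hxf⟩⟩
  have hU : #(M.biUnion id) ≤ 3 * (s - #S) := by
    rw [hcard, mul_comm]
    exact card_biUnion_le_card_mul _ _ _ fun e he => (h3K e (hMK he)).le
  refine (card_le_card hsub).trans ((card_biUnion_le_card_mul _ _ _ fun x hx => hdeg x ?_).trans
    (Nat.mul_le_mul_right _ hU))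
  obtain ⟨e, he, hxe⟩ := mem_biUnion.1 hx
  exact disjoint_left.1 (mem_filter.1 (hMK he)).2 hxe

lemma removal_arith_of_three_le {n s t : ℤ} (ht : 3 ≤ t) (hts : t < s) (hn : 30 * (s + 1) ≤ n) :
    t * (n - t) ^ 2 + 12 * (s - t) ^ 2 * (n + 6) + s < s * (n - s) ^ 2 := by
  obtain ⟨a, rfl⟩ : ∃ a, t = 3 + a := ⟨t - 3, by ring⟩
  obtain ⟨b, rfl⟩ : ∃ b, s = 3 + a + 1 + b := ⟨s - (3 + a + 1), by ring⟩
  obtain ⟨k, rfl⟩ : ∃ k, n = 30 * (3 + a + 1 + b + 1) + k := ⟨n - 30 * (3 + a + 1 + b + 1), by ring⟩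
  have ha : 0 ≤ a := by linarith
  have hb : 0 ≤ b := by linarith
  have hk : 0 ≤ k := by linarith
  rw [← sub_pos]
  ring_nf
  positivity

lemma removal_arith_of_le_two {n s : ℤ} (hs : 3 ≤ s) (hn : 30 * (s + 1) ≤ n) :
    (2 * (n - 2) ^ 2 + 4 * n + 12 * (s - 2) ^ 2 * (n + 6) + s < s * (n - s) ^ 2) ∧
    (2 * (n - 1) ^ 2 + 12 * (s - 1) ^ 2 * (n + 6) + s < s * (n - s) ^ 2) ∧
    12 * s ^ 2 * (n + 6) + s < s * (n - s) ^ 2 := by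
  obtain ⟨b, rfl⟩ : ∃ b, s = 3 + b := ⟨s - 3, by ring⟩
  obtain ⟨k, rfl⟩ : ∃ k, n = 30 * (3 + b + 1) + k := ⟨n - 30 * (3 + b + 1), by ring⟩
  have hb : 0 ≤ b := by linarith
  have hk : 0 ≤ k := by linarith
  refine ⟨?_, ?_, ?_⟩ <;> (rw [← sub_pos]; ring_nf; positivity)

lemma card_lt_of_card_removal_lt (h3 : IsThreeGraph H) (hF5 : F5Free H) {s : ℕ} (hs : 3 ≤ s)
    (hn : 30 * (s + 1) ≤ n) {S : Finset (Fin n)} (hSs : #S < s)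
    (hK : #{e ∈ H | Disjoint e S} ≤ 3 * (s - #S) * ((s - #S) * (n + 6))) :
    #H < s * ((n - s) ^ 2 / 4) := by
  have hsplit : #{e ∈ H | Disjoint e S} + #{e ∈ H | ¬ Disjoint e S} = #H :=
    card_filter_add_card_filter_not _
  have htouch := two_mul_card_touching_le h3 S
  have hW : #Sᶜ + #S = n := card_compl_add_card_fin S
  have hfl := Nat.mul_le_mul_left s (sq_sub_self_le (n - s))
  have hp : (#Sᶜ : ℤ) = n - #S := by omega
  have hns : ((n - s : ℕ) : ℤ) = n - s := by omega
  have hms : ((s - #S : ℕ) : ℤ) = s - #S := by omega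
  have hs' : (3 : ℤ) ≤ s := by exact_mod_cast hs
  have hn' : 30 * ((s : ℤ) + 1) ≤ n := by exact_mod_cast hn
  suffices h : 2 * (2 * (#{e ∈ H | ¬ Disjoint e S} : ℤ)) +
      12 * ((s : ℤ) - #S) ^ 2 * (n + 6) + s < s * ((n : ℤ) - s) ^ 2 by
    zify at hK hsplit hfl ⊢
    rw [hns] at hfl ⊢
    rw [hms] at hK
    linarith
  have key := removal_arith_of_le_two hs' hn'
  rcases Nat.lt_or_ge 2 #S with h | h
  · have h1 := htouch.trans (sum_touching_le h3 hF5 h (by omega)).1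
    have h2 := removal_arith_of_three_le (t := #S) (by exact_mod_cast h)
      (by exact_mod_cast hSs) hn'
    have h4 := Nat.mul_le_mul_left #S (Nat.mul_div_le (#Sᶜ ^ 2) 4)
    zify at h1 h4
    rw [hp] at h1 h4
    linarith
  interval_cases hc : #S
  · rw [card_eq_zero.1 hc] at htouch ⊢
    simp only [sum_empty] at htouch
    push_cast
    linarith [key.2.2, (by exact_mod_cast htouch : 2 * (#{e ∈ H | ¬ Disjoint e ∅} : ℤ) ≤ 0)]
  · obtain ⟨u, hu⟩ := card_eq_one.1 hc
    have h1 := pairCount_le_sq (link H S u) Sᶜ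
    have h2 := codegree_self h3 u
    have h4 : 2 * #{e ∈ H | ¬ Disjoint e S} ≤ #Sᶜ ^ 2 := by
      refine htouch.trans ?_
      have hsum : ∀ f : Fin n → ℕ, ∑ x ∈ S, f x = f u := fun f => by rw [hu, sum_singleton]
      simp only [hsum]
      omega
    zify at h4
    rw [hp] at h4
    push_cast at h4 ⊢
    linarith [key.2.1]
  · obtain ⟨u, v, huv, hu⟩ := card_eq_two.1 hc
    have h1 := pairCount_link_add_le h3 hF5 (S := S) (by simp [hu]) (by simp [hu]) huv
    have h2 := codegree_self h3 u
    have h4 := codegree_self h3 v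
    have h5 := codegree_le (H := H) u v
    have h6 := codegree_le (H := H) v u
    have h7 := Nat.mul_div_le (#Sᶜ ^ 2) 4
    have h8 : 2 * #{e ∈ H | ¬ Disjoint e S} ≤ #Sᶜ ^ 2 + 2 * n := by
      refine htouch.trans ?_
      have hsum : ∀ f : Fin n → ℕ, ∑ x ∈ S, f x = f u + f v := fun f => by
        rw [hu, sum_pair huv]
      simp only [hsum]
      omega
    zify at h8
    rw [hp] at h8
    push_cast at h8 ⊢
    linarith [key.1]

end Peeling

section Structure

variable {n : ℕ} {H : Finset (Finset (Fin n))}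

lemma exists_common_bipartition (h3 : IsThreeGraph H) (hF5 : F5Free H) {S : Finset (Fin n)}
    (hS : 2 ≤ #S) (hW : 2 ≤ #Sᶜ)
    (hlink : ∀ u ∈ S, pairCount (link H S u) Sᶜ = 2 * (#Sᶜ ^ 2 / 4)) :
    ∃ X Y : Finset (Fin n), Disjoint X Y ∧ X ∪ Y = Sᶜ ∧ #X * #Y = #Sᶜ ^ 2 / 4 ∧
      ∀ u ∈ S, ∀ a ∈ Sᶜ, ∀ b ∈ Sᶜ, link H S u a b ↔ (a ∈ X ∧ b ∈ Y) ∨ (a ∈ Y ∧ b ∈ X) := by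
  have hpair : ∀ u ∈ S, ∀ v ∈ S, u ≠ v → _ := fun u hu v hv huv =>
    exists_bipartition_of_pairCount_eq (link_symm (H := H) S u) (link_symm S v)
      (link_irrefl h3 S u) (link_irrefl h3 S v) (noMixedTriangle_link h3 hF5 hv huv)
      (noMixedTriangle_link h3 hF5 hu huv.symm) hW (hlink u hu) (hlink v hv)
  obtain ⟨u, hu, v, hv, huv⟩ := one_lt_card.1 hS
  obtain ⟨X, Y, hd, hun, hc, hXY⟩ := hpair u hu v hv huv
  refine ⟨X, Y, hd, hun, hc, fun w hw a ha b hb => ?_⟩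
  rcases eq_or_ne u w with rfl | huw
  · exact (hXY a ha b hb).1
  · obtain ⟨X', Y', -, -, -, h⟩ := hpair u hu w hw huw
    rw [← (hXY a ha b hb).1, (h a ha b hb).1, (h a ha b hb).2]

lemma card_eq_of_mul_eq {x y : ℕ} (h : x * y = (x + y) ^ 2 / 4) (hxy : x ≤ y) :
    x = (x + y) / 2 ∧ y = (x + y + 1) / 2 := by
  obtain ⟨d, rfl⟩ := Nat.exists_eq_add_of_le hxy
  have h1 := sq_sub_self_le (x + (x + d))
  have h2 : d < 2 := by
    by_contra! h2
    rw [← h] at h1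
    nlinarith
  omega

end Structure

theorem ex3_F5_matching_uniqueness (n s : ℕ) (hs : 3 ≤ s) (hn : 30 * (s + 1) ≤ n)
    (H : Finset (Finset (Fin n))) (h3 : IsThreeGraph H) (hF5 : F5Free H)
    (hν : MatchingNumLE H s) (hcard : H.card = s * ((n - s) ^ 2 / 4)) :
    ∃ P₁ P₂ P₃ : Finset (Fin n),
      Disjoint P₁ P₂ ∧ Disjoint P₁ P₃ ∧ Disjoint P₂ P₃ ∧
      P₁ ∪ P₂ ∪ P₃ = Finset.univ ∧
      P₁.card = s ∧ P₂.card = (n - s) / 2 ∧ P₃.card = (n - s + 1) / 2 ∧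
      ∀ e : Finset (Fin n), e ∈ H ↔
        ∃ a ∈ P₁, ∃ b ∈ P₂, ∃ c ∈ P₃, e = {a, b, c} := by
  obtain ⟨S, hSs, hK⟩ := exists_removal h3 hF5 (by omega) hν
  have hSs : #S = s := by
    refine hSs.antisymm ?_
    by_contra! hlt
    exact (card_lt_of_card_removal_lt h3 hF5 hs hn hlt hK).ne hcard
  subst hSs
  have hW : #Sᶜ + #S = n := card_compl_add_card_fin S
  have hWn : n - #S = #Sᶜ := by omega
  rw [hWn] at hcard ⊢
  rw [Nat.sub_self, mul_zero, zero_mul, Nat.le_zero, card_eq_zero, filter_eq_empty_iff] at hK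
  have htouch := two_mul_card_touching_le h3 S
  rw [filter_true_of_mem hK] at htouch
  obtain ⟨hle, heq⟩ := sum_touching_le h3 hF5 hs hn
  obtain ⟨hzero, hlink⟩ := heq (hle.antisymm (by linarith))
  obtain ⟨X, Y, hd, hun, hc, hXY⟩ :=
    exists_common_bipartition h3 hF5 (by omega) (by omega) hlink
  have hcXY : #X + #Y = #Sᶜ := by rw [← hun, card_union_of_disjoint hd]
  wlog hle' : #X ≤ #Y generalizing X Y
  · refine this Y X hd.symm (by rw [union_comm, hun]) (by rw [mul_comm, hc])
      (fun u hu a ha b hb => ?_) (by omega) (by omega)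
    rw [hXY u hu a ha b hb, or_comm]
  have hcards := card_eq_of_mul_eq (hcXY.symm ▸ hc) hle'
  rw [hcXY] at hcards
  have hXS : X ⊆ Sᶜ := hun ▸ subset_union_left
  have hYS : Y ⊆ Sᶜ := hun ▸ subset_union_right
  refine ⟨S, X, Y, disjoint_left.2 fun a ha h => mem_compl.1 (hXS h) ha,
    disjoint_left.2 fun a ha h => mem_compl.1 (hYS h) ha, hd, ?_, rfl, hcards.1, hcards.2,
    fun e => ⟨fun he => ?_, ?_⟩⟩
  · rw [union_assoc, hun, union_compl]
  · obtain ⟨u, hue, huS⟩ := not_disjoint_iff.1 (hK he)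
    have hc2 : #(e.erase u) = 2 := by rw [card_erase_of_mem hue, h3 e he]
    obtain ⟨a, b, -, heab⟩ := card_eq_two.1 hc2
    have hee : e = {u, a, b} := by rw [← heab, insert_erase hue]
    have hnot : ∀ x y : Fin n, ({u, x, y} : Finset (Fin n)) ∈ H → x ∉ S := fun x y hxy hx =>
      notMem_empty y (card_eq_zero.1 (hzero u huS x hx) ▸ mem_filter.2 ⟨mem_univ _, hxy⟩)
    rw [hee] at he
    have ha := hnot a b he
    have hb := hnot b a (triple_swap u a b ▸ he)
    rcases (hXY u huS a (mem_compl.2 ha) b (mem_compl.2 hb)).1 ⟨ha, hb, he⟩ with h | h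
    · exact ⟨u, huS, a, h.1, b, h.2, hee⟩
    · exact ⟨u, huS, b, h.2, a, h.1, hee.trans (triple_swap u a b)⟩
  · rintro ⟨u, hu, a, ha, b, hb, rfl⟩
    exact ((hXY u hu a (hXS ha) b (hYS hb)).2 (Or.inl ⟨ha, hb⟩)).2.2
end

section
/- Let p ≥ 2 and let G_1,…,G_p be graphs on vertex set [n] that are 2-colored triangle free. Then the product of their numbers of edges satisfies Π_{i=1}^{p} e(G_i) ≤ ⌊n²/4⌋^p, and equality holds if and only if G_1 = ⋯ = G_p is a complete bipartite graph K_{⌊n/2⌋,⌈n/2⌉} with parts of sizes ⌊n/2⌋ and ⌈n/2⌉. -/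
open Finset

/-- Graphs `G 1, …, G p` (edges of `G i` colored `i`) are 2-colored triangle free:
there are no vertices `x, y, z` and distinct colors `i ≠ j` with
`xy, xz ∈ E(G i)` and `yz ∈ E(G j)`. -/
def TwoColoredTriangleFree {n p : ℕ} (G : Fin p → SimpleGraph (Fin n)) : Prop :=
  ¬ ∃ (i j : Fin p) (x y z : Fin n),
      i ≠ j ∧ (G i).Adj x y ∧ (G i).Adj x z ∧ (G j).Adj y z

/-- The 0/1 indicator of adjacency. -/
def SimpleGraph.adjIndicator {V : Type*} (G : SimpleGraph V) [DecidableRel G.Adj] (a b : V) : ℕ :=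
  if G.Adj a b then 1 else 0

theorem four_mul_sq_div_four_add_two (m : ℕ) :
    4 * ((m + 2) ^ 2 / 4) = 4 * (m ^ 2 / 4) + 4 * m + 4 := by
  have : (m + 2) ^ 2 = m ^ 2 + 4 * (m + 1) := by ring
  omega

theorem mul_pred_lt_four_mul_sq_div_four {m : ℕ} (hm : 2 ≤ m) :
    m * (m - 1) < 4 * (m ^ 2 / 4) := by
  obtain ⟨k, rfl | rfl⟩ := Nat.even_or_odd' m
  · have h1 : (2 * k) ^ 2 = 4 * k ^ 2 := by ring
    obtain ⟨l, rfl⟩ : ∃ l, k = l + 1 := ⟨k - 1, by omega⟩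
    have h2 : 2 * (l + 1) - 1 = 2 * l + 1 := by omega
    rw [h1, h2, Nat.mul_div_cancel_left _ (by norm_num)]
    nlinarith
  · have h1 : (2 * k + 1) ^ 2 = 1 + 4 * (k * (k + 1)) := by ring
    rw [h1, Nat.add_mul_div_left _ _ (by norm_num)]
    simp only [Nat.add_sub_cancel]
    have : 1 ≤ k := by omega
    norm_num
    nlinarith

theorem sum_sum_eq_of_forall_sum_eq {V : Type*} {w : V → V → ℕ} {S T : Finset V} {x y : V}
    (hsum : ∀ f : V → ℕ, ∑ a ∈ S, f a = ∑ a ∈ T, f a + f x + f y)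
    (w_symm : ∀ a b, w a b = w b a) :
    ∑ a ∈ S, ∑ b ∈ S, w a b = ∑ a ∈ T, ∑ b ∈ T, w a b + 2 * ∑ z ∈ T, (w x z + w y z) +
      (w x x + w y y + 2 * w x y) := by
  have hx : ∑ a ∈ T, w a x = ∑ a ∈ T, w x a := sum_congr rfl fun a _ => w_symm a x
  have hy : ∑ a ∈ T, w a y = ∑ a ∈ T, w y a := sum_congr rfl fun a _ => w_symm a y
  rw [hsum, hsum (w x), hsum (w y), sum_congr rfl fun a _ => hsum (w a), sum_add_distrib,
    sum_add_distrib, sum_add_distrib, hx, hy, w_symm y x]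
  ring

/-- Two-colour weighted Mantel theorem on a vertex subset `S`, counting ordered pairs. -/
theorem sum_adjIndicator_le {V : Type*} [DecidableEq V] (R B : SimpleGraph V)
    [DecidableRel R.Adj] [DecidableRel B.Adj]
    (hRB : ∀ x y z, R.Adj x y → R.Adj x z → ¬ B.Adj y z)
    (hBR : ∀ x y z, B.Adj x y → B.Adj x z → ¬ R.Adj y z) (S : Finset V) :
    (∑ a ∈ S, ∑ b ∈ S, (R.adjIndicator a b + B.adjIndicator a b) ≤ 4 * (#S ^ 2 / 4)) ∧
      (∑ a ∈ S, ∑ b ∈ S, (R.adjIndicator a b + B.adjIndicator a b) = 4 * (#S ^ 2 / 4) →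
        ∀ a ∈ S, ∀ b ∈ S, R.Adj a b ↔ B.Adj a b) := by
  induction S using Finset.strongInduction with
  | H S ih =>
    set w : V → V → ℕ := fun a b => R.adjIndicator a b + B.adjIndicator a b with hw
    have w_symm : ∀ a b, w a b = w b a := by
      intro a b
      simp only [hw, SimpleGraph.adjIndicator, R.adj_comm a b, B.adj_comm a b]
    have w_self : ∀ a, w a a = 0 := by simp [hw, SimpleGraph.adjIndicator]
    by_cases hxy : ∃ x ∈ S, ∃ y ∈ S, R.Adj x y ∧ B.Adj x y
    · obtain ⟨x, hx, y, hy, hR, hB⟩ := hxy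
      set T := (S.erase x).erase y with hT
      have hne : y ≠ x := hR.ne'
      have hyS : y ∈ S.erase x := mem_erase.2 ⟨hne, hy⟩
      have hTS : T ⊂ S := (erase_ssubset hyS).trans (erase_ssubset hx)
      have hcard : #S = #T + 2 := by
        rw [hT, card_erase_of_mem hyS, card_erase_of_mem hx]
        have : #(S.erase x) > 0 := card_pos.2 ⟨y, hyS⟩
        rw [card_erase_of_mem hx] at this
        omega
      have hsum : ∀ f : V → ℕ, ∑ a ∈ S, f a = ∑ a ∈ T, f a + f x + f y := by
        intro f
        rw [← add_sum_erase S f hx, ← add_sum_erase _ f hyS]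
        ring
      have hwxy : w x y = 2 := by simp [hw, SimpleGraph.adjIndicator, hR, hB]
      have htot : ∑ a ∈ S, ∑ b ∈ S, w a b =
          ∑ a ∈ T, ∑ b ∈ T, w a b + 2 * ∑ z ∈ T, (w x z + w y z) + 4 := by
        rw [sum_sum_eq_of_forall_sum_eq hsum w_symm, w_self, w_self, hwxy]
      have hz : ∀ z, w x z + w y z ≤ 2 ∧
          (w x z + w y z = 2 → (R.Adj x z ↔ B.Adj x z) ∧ (R.Adj y z ↔ B.Adj y z)) := by
        intro z
        have h1 := hRB z x y
        have h2 := hBR z x y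
        have h3 := hRB x y z
        have h4 := hBR x y z
        have h5 := hRB y x z
        have h6 := hBR y x z
        simp only [hw, SimpleGraph.adjIndicator]
        simp only [hR, hB, hR.symm, hB.symm, R.adj_comm z x, R.adj_comm z y,
          B.adj_comm z x, B.adj_comm z y] at h1 h2 h3 h4 h5 h6
        split_ifs <;> grind
      have hle : ∑ z ∈ T, (w x z + w y z) ≤ ∑ z ∈ T, 2 := sum_le_sum fun z _ => (hz z).1
      have hle' := hle
      rw [sum_const, smul_eq_mul] at hle'
      obtain ⟨ih1, ih2⟩ := ih T hTS
      change ∑ a ∈ T, ∑ b ∈ T, w a b ≤ _ at ih1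
      change ∑ a ∈ T, ∑ b ∈ T, w a b = _ → _ at ih2
      change ∑ a ∈ S, ∑ b ∈ S, w a b ≤ _ ∧ (∑ a ∈ S, ∑ b ∈ S, w a b = _ → _)
      rw [htot, hcard, four_mul_sq_div_four_add_two]
      refine ⟨by omega, fun heq => ?_⟩
      have hTeq := ih2 (by omega)
      have hzeq : ∀ z ∈ T, w x z + w y z = 2 :=
        (sum_eq_sum_iff_of_le fun z _ => (hz z).1).1 (by rw [sum_const, smul_eq_mul]; omega)
      have hSmem : ∀ a ∈ S, a = x ∨ a = y ∨ a ∈ T := by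
        intro a ha
        simp only [hT, mem_erase]
        tauto
      intro a ha b hb
      rcases hSmem a ha with rfl | rfl | ha' <;> rcases hSmem b hb with rfl | rfl | hb'
      · simp
      · simp [hR, hB]
      · exact ((hz b).2 (hzeq b hb')).1
      · simp [hR.symm, hB.symm]
      · simp
      · exact ((hz b).2 (hzeq b hb')).2
      · rw [R.adj_comm, B.adj_comm]; exact ((hz a).2 (hzeq a ha')).1
      · rw [R.adj_comm, B.adj_comm]; exact ((hz a).2 (hzeq a ha')).2
      · exact hTeq a ha' b hb'
    · push Not at hxy
      have hle : ∑ a ∈ S, ∑ b ∈ S, w a b ≤ #S * (#S - 1) := by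
        refine (sum_le_card_nsmul S _ (#S - 1) fun a ha => ?_).trans_eq (by simp)
        rw [← add_sum_erase S _ ha, w_self, zero_add]
        refine (sum_le_card_nsmul _ _ 1 fun b hb => ?_).trans_eq (by simp [card_erase_of_mem ha])
        have := hxy a ha b (mem_of_mem_erase hb)
        simp only [hw, SimpleGraph.adjIndicator]
        split_ifs <;> simp_all
      change ∑ a ∈ S, ∑ b ∈ S, w a b ≤ _ ∧ (∑ a ∈ S, ∑ b ∈ S, w a b = _ → _)
      by_cases h2 : 2 ≤ #S
      · have := mul_pred_lt_four_mul_sq_div_four h2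
        exact ⟨by omega, fun h => by omega⟩
      · refine ⟨?_, fun _ a ha b hb => ?_⟩
        · have h0 : #S * (#S - 1) = 0 := by
            rw [Nat.sub_eq_zero_of_le (by omega), mul_zero]
          omega
        · rw [card_le_one.1 (by omega) a ha b hb]
          simp

theorem SimpleGraph.sum_adjIndicator_univ {V : Type*} [Fintype V] [DecidableEq V]
    (G : SimpleGraph V) [DecidableRel G.Adj] :
    ∑ a, ∑ b, G.adjIndicator a b = 2 * #G.edgeFinset := by
  rw [SimpleGraph.two_mul_card_edgeFinset, card_filter, ← univ_product_univ, sum_product]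
  rfl

/-- Two-colour weighted Mantel theorem: two graphs without 2-coloured triangles have at most
`2 * ⌊n² / 4⌋` edges altogether, and they coincide in case of equality. -/
theorem card_edgeFinset_add_le {n : ℕ} (R B : SimpleGraph (Fin n))
    [DecidableRel R.Adj] [DecidableRel B.Adj]
    (hRB : ∀ x y z, R.Adj x y → R.Adj x z → ¬ B.Adj y z)
    (hBR : ∀ x y z, B.Adj x y → B.Adj x z → ¬ R.Adj y z) :
    #R.edgeFinset + #B.edgeFinset ≤ 2 * (n ^ 2 / 4) ∧
      (#R.edgeFinset + #B.edgeFinset = 2 * (n ^ 2 / 4) → R = B) := by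
  have key := sum_adjIndicator_le R B hRB hBR univ
  simp only [sum_add_distrib, SimpleGraph.sum_adjIndicator_univ, card_univ, Fintype.card_fin]
    at key
  refine ⟨by omega, fun heq => ?_⟩
  ext a b
  exact key.2 (by omega) a (mem_univ a) b (mem_univ b)

theorem card_edgeFinset_of_adj_iff_bipartition {V : Type*} [Fintype V] [DecidableEq V]
    (G : SimpleGraph V) [DecidableRel G.Adj] {P Q : Finset V} (hPQ : Disjoint P Q)
    (hG : ∀ x y, G.Adj x y ↔ (x ∈ P ∧ y ∈ Q) ∨ (x ∈ Q ∧ y ∈ P)) :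
    #G.edgeFinset = #P * #Q := by
  have h : univ.filter (fun (x, y) => G.Adj x y) = P ×ˢ Q ∪ Q ×ˢ P := by
    ext ⟨x, y⟩
    simp [hG]
  have h2 := G.two_mul_card_edgeFinset
  rw [h, card_union_of_disjoint (disjoint_product.2 (Or.inl hPQ)), card_product, card_product,
    mul_comm #Q] at h2
  omega

theorem half_mul_half_succ (n : ℕ) : n / 2 * ((n + 1) / 2) = n ^ 2 / 4 := by
  obtain ⟨k, rfl | rfl⟩ := Nat.even_or_odd' n
  · have h1 : (2 * k) ^ 2 = 4 * (k * k) := by ring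
    have h2 : (2 * k + 1) / 2 = k := by omega
    rw [h1, h2, Nat.mul_div_cancel_left _ (by norm_num), Nat.mul_div_cancel_left _ (by norm_num)]
  · have h1 : (2 * k + 1) ^ 2 = 1 + 4 * (k * (k + 1)) := by ring
    have h2 : (2 * k + 1) / 2 = k := by omega
    have h3 : (2 * k + 1 + 1) / 2 = k + 1 := by omega
    rw [h1, h2, h3, Nat.add_mul_div_left _ _ (by norm_num)]
    norm_num

theorem eq_half_of_mul_eq {a b n : ℕ} (hab : a + b = n) (h : a * b = n ^ 2 / 4) :
    (a = n / 2 ∧ b = (n + 1) / 2) ∨ (b = n / 2 ∧ a = (n + 1) / 2) := by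
  wlog hle : a ≤ b generalizing a b
  · exact (this (by omega) (by rw [mul_comm, h]) (by omega)).symm
  left
  obtain ⟨d, rfl⟩ := Nat.exists_eq_add_of_le hle
  have h1 : n ^ 2 = 4 * (a * (a + d)) + d ^ 2 := by rw [← hab]; ring
  have h2 : d ^ 2 < 4 := by omega
  have h3 : d < 2 := by nlinarith
  omega

/-- The extremal graphs in Mantel's theorem are the balanced complete bipartite graphs. -/
theorem SimpleGraph.exists_bipartition_of_cliqueFree_three {n : ℕ} (G : SimpleGraph (Fin n))
    [DecidableRel G.Adj] (hG : G.CliqueFree 3) (hcard : #G.edgeFinset = n ^ 2 / 4) :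
    ∃ P Q : Finset (Fin n), Disjoint P Q ∧ P ∪ Q = univ ∧ #P = n / 2 ∧ #Q = (n + 1) / 2 ∧
      ∀ x y, G.Adj x y ↔ (x ∈ P ∧ y ∈ Q) ∨ (x ∈ Q ∧ y ∈ P) := by
  have hmax : G.IsTuranMaximal 2 := by
    refine ⟨hG, fun H _ hH => ?_⟩
    have hle := hH.card_edgeFinset_le (r := 2)
    simp only [Fintype.card_fin] at hle
    have h0 : (n % 2).choose 2 = 0 := Nat.choose_eq_zero_of_lt (Nat.mod_lt _ (by norm_num))
    rw [h0] at hle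
    rw [hcard]
    refine hle.trans ?_
    simp only [Nat.add_one_sub_one, mul_one, add_zero]
    exact Nat.div_le_div_right (Nat.sub_le _ _)
  obtain ⟨f⟩ := hmax.nonempty_iso_turanGraph
  set P := univ.filter fun x => (f x : ℕ) % 2 = 1 with hP
  have hadj : ∀ x y, G.Adj x y ↔ (x ∈ P ∧ y ∈ Pᶜ) ∨ (x ∈ Pᶜ ∧ y ∈ P) := by
    intro x y
    rw [← f.map_adj_iff, SimpleGraph.turanGraph_adj]
    simp only [hP, mem_compl, mem_filter, mem_univ, true_and]
    omega
  have hmul := card_edgeFinset_of_adj_iff_bipartition G disjoint_compl_right hadj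
  have hadd : #P + #Pᶜ = n := by rw [card_add_card_compl, Fintype.card_fin]
  rcases eq_half_of_mul_eq hadd (hmul.symm.trans hcard) with ⟨h1, h2⟩ | ⟨h1, h2⟩
  · exact ⟨P, Pᶜ, disjoint_compl_right, union_compl P, h1, h2, hadj⟩
  · exact ⟨Pᶜ, P, disjoint_compl_left, by rw [union_comm, union_compl], h1, h2,
      fun x y => (hadj x y).trans or_comm⟩

/-- If any two of `p ≥ 2` natural numbers have average at most `f`, then their product is at most
`f ^ p`, with equality only if all of them equal `f`. -/
theorem prod_le_pow_of_pairwise_add_le {p f : ℕ} (hp : 2 ≤ p) (e : Fin p → ℕ)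
    (he : ∀ i j, i ≠ j → e i + e j ≤ 2 * f) :
    ∏ i, e i ≤ f ^ p ∧ (∏ i, e i = f ^ p → ∀ i, e i = f) := by
  set σ := finRotate p
  have hσ : ∀ i, i ≠ σ i := by
    obtain ⟨q, rfl⟩ := Nat.exists_eq_add_of_le' hp
    intro i hi
    simp [σ] at hi
  have hle : ∀ i, e i * e (σ i) ≤ f ^ 2 := by
    intro i
    have := he i (σ i) (hσ i)
    zify at *
    nlinarith [sq_nonneg ((e i : ℤ) - e (σ i))]
  have hsq : ∏ i, (e i * e (σ i)) = (∏ i, e i) ^ 2 := by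
    rw [prod_mul_distrib, Equiv.prod_comp σ e, sq]
  have hconst : ∏ _i : Fin p, f ^ 2 = (f ^ p) ^ 2 := by
    rw [prod_const, card_univ, Fintype.card_fin, ← pow_mul, ← pow_mul, mul_comm]
  refine ⟨?_, fun heq => ?_⟩
  · rw [← Nat.pow_le_pow_iff_left (two_ne_zero), ← hsq, ← hconst]
    exact prod_le_prod' fun i _ => hle i
  · have hpair : ∀ i, e i * e (σ i) = f ^ 2 := by
      rcases Nat.eq_zero_or_pos f with rfl | hf
      · intro i
        have := hle i
        simpa using this
      · have hpos : ∀ i, 0 < e i := by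
          intro i
          rw [Nat.pos_iff_ne_zero]
          intro h0
          rw [prod_eq_zero (mem_univ i) h0] at heq
          exact (pow_pos hf p).ne heq
        by_contra! hne
        obtain ⟨i, hi⟩ := hne
        refine (prod_lt_prod (s := univ) (fun i _ => Nat.mul_pos (hpos i) (hpos (σ i)))
          (fun i _ => hle i) ⟨i, mem_univ i, lt_of_le_of_ne (hle i) hi⟩).ne ?_
        rw [hsq, hconst, heq]
    intro i
    have h1 := he i (σ i) (hσ i)
    have h2 := hpair i
    zify at *
    have h3 : ((e i : ℤ) - e (σ i)) ^ 2 ≤ 0 := by nlinarith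
    have h4 : (e i : ℤ) = e (σ i) := by
      have := pow_eq_zero_iff (two_ne_zero) |>.1 (le_antisymm h3 (sq_nonneg _))
      linarith
    rw [← h4, ← sq] at h2
    exact (sq_eq_sq₀ (by positivity) (by positivity)).1 h2

theorem two_colored_mantel_product (n p : ℕ) (hp : 2 ≤ p)
    (G : Fin p → SimpleGraph (Fin n)) [∀ i, DecidableRel (G i).Adj]
    (h : TwoColoredTriangleFree G) :
    (∏ i, (G i).edgeFinset.card ≤ (n ^ 2 / 4) ^ p) ∧
      ((∏ i, (G i).edgeFinset.card = (n ^ 2 / 4) ^ p) ↔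
        ∃ P₁ P₂ : Finset (Fin n), Disjoint P₁ P₂ ∧ P₁ ∪ P₂ = Finset.univ ∧
          P₁.card = n / 2 ∧ P₂.card = (n + 1) / 2 ∧
          ∀ (i : Fin p) (x y : Fin n),
            (G i).Adj x y ↔ (x ∈ P₁ ∧ y ∈ P₂) ∨ (x ∈ P₂ ∧ y ∈ P₁)) := by
  have hfree : ∀ i j, i ≠ j → ∀ x y z, (G i).Adj x y → (G i).Adj x z → ¬ (G j).Adj y z :=
    fun i j hij x y z h1 h2 h3 => h ⟨i, j, x, y, z, hij, h1, h2, h3⟩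
  have hpair := fun i j (hij : i ≠ j) =>
    card_edgeFinset_add_le (G i) (G j) (hfree i j hij) (hfree j i hij.symm)
  obtain ⟨hle, heq⟩ := prod_le_pow_of_pairwise_add_le hp (fun i => #(G i).edgeFinset)
    fun i j hij => (hpair i j hij).1
  refine ⟨hle, fun hprod => ?_, ?_⟩
  · have hcard := heq hprod
    have hG : ∀ i j, G i = G j := by
      intro i j
      by_cases hij : i = j
      · rw [hij]
      · exact (hpair i j hij).2 (by simp only [hcard]; ring)
    let i₀ : Fin p := ⟨0, by omega⟩
    let i₁ : Fin p := ⟨1, by omega⟩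
    have h01 : i₀ ≠ i₁ := by simp [i₀, i₁]
    have hcf : (G i₀).CliqueFree 3 := by
      intro s hs
      obtain ⟨x, y, z, hxy, hxz, hyz, -⟩ := SimpleGraph.is3Clique_iff.1 hs
      exact hfree i₀ i₁ h01 x y z hxy hxz (hG i₀ i₁ ▸ hyz)
    obtain ⟨P, Q, h1, h2, h3, h4, h5⟩ :=
      (G i₀).exists_bipartition_of_cliqueFree_three hcf (hcard i₀)
    exact ⟨P, Q, h1, h2, h3, h4, fun i => hG i₀ i ▸ h5⟩
  · rintro ⟨P, Q, hdisj, -, hP, hQ, hadj⟩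
    simp only [card_edgeFinset_of_adj_iff_bipartition (G _) hdisj (hadj _), hP, hQ,
      half_mul_half_succ, prod_const, card_univ, Fintype.card_fin]
end
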